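/- (Proposition 1, infimum part.) For every α ∈ (0,1), the infimum over p ∈ R_c of the α-th p-posterior quantile of h equals the (α / (α + (1 − α)·c²))-th L-posterior quantile of h: inf_{p ∈ R_c} Q_p(α) = Q_L( α / (α + (1 − α)·c²) ). -/

import Mathlib

open MeasureTheory

/-- The `p`-posterior probability of a set `A`. -/
noncomputable def postProb {X : Type*} [MeasurableSpace X] (π : Measure X)
    (p : X → ℝ) (A : Set X) : ℝ :=
  (∫ x in A, p x ∂π) / (∫ x, p x ∂π)

/-- The `α`-th `p`-posterior quantile of `h`. -/
noncomputable def postQuantile {X : Type*} [MeasurableSpace X] (π : Measure X)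
    (p : X → ℝ) (h : X → ℝ) (α : ℝ) : ℝ :=
  sInf {q : ℝ | α ≤ postProb π p {x | h x ≤ q}}

theorem le_postProb_iff {X : Type*} [MeasurableSpace X] {π : Measure X} {p : X → ℝ}
    (hp : Integrable p π) (hpos : 0 < ∫ x, p x ∂π) {A : Set X} (hA : MeasurableSet A) (α : ℝ) :
    α ≤ postProb π p A ↔ α * ∫ x in Aᶜ, p x ∂π ≤ (1 - α) * ∫ x in A, p x ∂π := by
  rw [postProb, le_div_iff₀ hpos, ← integral_add_compl hA hp]
  constructor <;> intro _ <;> linarith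

theorem integrable_of_densityRatio {X : Type*} [MeasurableSpace X] {π : Measure X}
    {L p : X → ℝ} {c : ℝ} (hc : 0 < c) (hLnonneg : ∀ x, 0 ≤ L x) (hLint : Integrable L π)
    (hpm : Measurable p) (hp : ∀ x, L x / c ≤ p x ∧ p x ≤ c * L x) : Integrable p π := by
  refine (hLint.const_mul c).mono' hpm.aestronglyMeasurable (.of_forall fun x => ?_)
  rw [Real.norm_of_nonneg ((div_nonneg (hLnonneg x) hc.le).trans (hp x).1)]
  exact (hp x).2

theorem integral_pos_of_densityRatio {X : Type*} [MeasurableSpace X] {π : Measure X}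
    {L p : X → ℝ} {c : ℝ} (hc : 0 < c) (hLint : Integrable L π) (hLpos : 0 < ∫ x, L x ∂π)
    (hpint : Integrable p π) (hp : ∀ x, L x / c ≤ p x ∧ p x ≤ c * L x) :
    0 < ∫ x, p x ∂π := by
  have h := integral_mono (hLint.div_const c) hpint fun x => (hp x).1
  rw [integral_div] at h
  exact (div_pos hLpos hc).trans_le h

theorem le_postProb_adjusted_iff {X : Type*} [MeasurableSpace X] {π : Measure X} {L : X → ℝ}
    (hLint : Integrable L π) (hLpos : 0 < ∫ x, L x ∂π) {c α : ℝ}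
    (hD : 0 < α + (1 - α) * c ^ 2) {A : Set X} (hA : MeasurableSet A) :
    α / (α + (1 - α) * c ^ 2) ≤ postProb π L A ↔
      α * ∫ x in Aᶜ, L x ∂π ≤ (1 - α) * c ^ 2 * ∫ x in A, L x ∂π := by
  rw [postProb, div_le_div_iff₀ hD hLpos, ← integral_add_compl hA hLint]
  constructor <;> intro _ <;> linarith

theorem le_postProb_adjusted_of_le {X : Type*} [MeasurableSpace X] {π : Measure X}
    {L p : X → ℝ} {c α : ℝ} (hc : 0 < c) (hα : α ∈ Set.Ioo (0 : ℝ) 1)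
    (hLnonneg : ∀ x, 0 ≤ L x) (hLint : Integrable L π) (hLpos : 0 < ∫ x, L x ∂π)
    (hpm : Measurable p) (hp : ∀ x, L x / c ≤ p x ∧ p x ≤ c * L x)
    {A : Set X} (hA : MeasurableSet A) (h : α ≤ postProb π p A) :
    α / (α + (1 - α) * c ^ 2) ≤ postProb π L A := by
  have h1 : 0 < 1 - α := sub_pos.2 hα.2
  have hpint := integrable_of_densityRatio hc hLnonneg hLint hpm hp
  rw [le_postProb_iff hpint (integral_pos_of_densityRatio hc hLint hLpos hpint hp) hA] at h
  rw [le_postProb_adjusted_iff hLint hLpos (add_pos hα.1 (by positivity)) hA]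
  have hup : ∫ x in A, p x ∂π ≤ c * ∫ x in A, L x ∂π := by
    rw [← integral_const_mul]
    exact integral_mono hpint.integrableOn (hLint.const_mul c).integrableOn fun x => (hp x).2
  have hlow : (∫ x in Aᶜ, L x ∂π) / c ≤ ∫ x in Aᶜ, p x ∂π := by
    rw [← integral_div]
    exact integral_mono (hLint.div_const c).integrableOn hpint.integrableOn fun x => (hp x).1
  calc α * ∫ x in Aᶜ, L x ∂π = c * (α * ((∫ x in Aᶜ, L x ∂π) / c)) := by field_simp
    _ ≤ c * (α * ∫ x in Aᶜ, p x ∂π) := by have := hα.1; gcongr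
    _ ≤ c * ((1 - α) * ∫ x in A, p x ∂π) := by gcongr
    _ ≤ c * ((1 - α) * (c * ∫ x in A, L x ∂π)) := by gcongr
    _ = (1 - α) * c ^ 2 * ∫ x in A, L x ∂π := by ring

theorem exists_densityRatio_le_postProb {X : Type*} [MeasurableSpace X] {π : Measure X}
    {L : X → ℝ} {c α : ℝ} (hc : 1 ≤ c) (hα : α ∈ Set.Ioo (0 : ℝ) 1)
    (hLmeas : Measurable L) (hLnonneg : ∀ x, 0 ≤ L x) (hLint : Integrable L π)
    (hLpos : 0 < ∫ x, L x ∂π) {A : Set X} (hA : MeasurableSet A)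
    (h : α / (α + (1 - α) * c ^ 2) ≤ postProb π L A) :
    ∃ p : X → ℝ, Measurable p ∧ (∀ x, L x / c ≤ p x ∧ p x ≤ c * L x) ∧
      α ≤ postProb π p A := by
  classical
  have h1 : 0 < 1 - α := sub_pos.2 hα.2
  have hc0 : 0 < c := by linarith
  have hle : ∀ x, L x / c ≤ c * L x := fun x =>
    (div_le_self (hLnonneg x) hc).trans (le_mul_of_one_le_left (hLnonneg x) hc)
  let p : X → ℝ := A.piecewise (fun x => c * L x) (fun x => L x / c)
  have hpm : Measurable p := (hLmeas.const_mul c).piecewise hA (hLmeas.div_const c)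
  have hp : ∀ x, L x / c ≤ p x ∧ p x ≤ c * L x := by
    intro x
    by_cases hx : x ∈ A <;> simp [p, hx, hle x]
  have hpint := integrable_of_densityRatio hc0 hLnonneg hLint hpm hp
  have hpA : ∫ x in A, p x ∂π = c * ∫ x in A, L x ∂π := by
    rw [← integral_const_mul]
    exact setIntegral_congr_fun hA fun x hx => Set.piecewise_eq_of_mem _ _ _ hx
  have hpC : ∫ x in Aᶜ, p x ∂π = (∫ x in Aᶜ, L x ∂π) / c := by
    rw [← integral_div]
    exact setIntegral_congr_fun hA.compl fun x hx => Set.piecewise_eq_of_notMem _ _ _ hx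
  refine ⟨p, hpm, hp, ?_⟩
  rw [le_postProb_iff hpint (integral_pos_of_densityRatio hc0 hLint hLpos hpint hp) hA,
    hpA, hpC, ← mul_div_assoc, div_le_iff₀ hc0]
  rw [le_postProb_adjusted_iff hLint hLpos (add_pos hα.1 (by positivity)) hA] at h
  linarith

/-- Proposition 1, infimum part: the infimum over the density-ratio class `R_c`
of `α`-th posterior quantiles of `h` equals the `α / (α + (1 - α) c²)`-th
`L`-posterior quantile of `h`. -/
theorem densityRatio_quantile_inf
    {X : Type*} [MeasurableSpace X] (π : Measure X) [SigmaFinite π]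
    (L : X → ℝ) (hLmeas : Measurable L) (hLnonneg : ∀ x, 0 ≤ L x)
    (hLint : Integrable L π) (hLpos : 0 < ∫ x, L x ∂π)
    (c : ℝ) (hc : 1 ≤ c)
    (h : X → ℝ) (hmeas : Measurable h)
    (hne : ∀ β ∈ Set.Ioo (0:ℝ) 1, ∀ p : X → ℝ, Measurable p →
      (∀ x, L x / c ≤ p x ∧ p x ≤ c * L x) →
      {q : ℝ | β ≤ postProb π p {x | h x ≤ q}}.Nonempty ∧
        BddBelow {q : ℝ | β ≤ postProb π p {x | h x ≤ q}})
    (α : ℝ) (hα : α ∈ Set.Ioo (0:ℝ) 1) :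
    sInf {r : ℝ | ∃ p : X → ℝ, Measurable p ∧ (∀ x, L x / c ≤ p x ∧ p x ≤ c * L x) ∧
        r = postQuantile π p h α} =
      postQuantile π L h (α / (α + (1 - α) * c ^ 2)) := by
  have hc0 : 0 < c := by linarith
  have h1 : 0 < 1 - α := sub_pos.2 hα.2
  have hα0 : 0 < α := hα.1
  have hβ : α / (α + (1 - α) * c ^ 2) ∈ Set.Ioo (0 : ℝ) 1 := by
    refine ⟨by positivity, ?_⟩
    rw [div_lt_one (by positivity)]
    exact lt_add_of_pos_right _ (by positivity)
  have hLmem : ∀ x, L x / c ≤ L x ∧ L x ≤ c * L x := fun x =>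
    ⟨div_le_self (hLnonneg x) hc, le_mul_of_one_le_left (hLnonneg x) hc⟩
  have hA : ∀ q, MeasurableSet {x | h x ≤ q} := fun q => measurableSet_le hmeas measurable_const
  obtain ⟨hLne, hLbdd⟩ := hne _ hβ L hLmeas hLmem
  have hlb : postQuantile π L h (α / (α + (1 - α) * c ^ 2)) ∈
      lowerBounds {r : ℝ | ∃ p : X → ℝ, Measurable p ∧
        (∀ x, L x / c ≤ p x ∧ p x ≤ c * L x) ∧ r = postQuantile π p h α} := by
    rintro r ⟨p, hpm, hp, rfl⟩
    exact csInf_le_csInf hLbdd (hne α hα p hpm hp).1 fun q hq =>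
      le_postProb_adjusted_of_le hc0 hα hLnonneg hLint hLpos hpm hp (hA q) hq
  apply le_antisymm
  · refine le_csInf hLne fun q hq => ?_
    obtain ⟨p, hpm, hp, hpq⟩ :=
      exists_densityRatio_le_postProb hc hα hLmeas hLnonneg hLint hLpos (hA q) hq
    exact (csInf_le ⟨_, hlb⟩ ⟨p, hpm, hp, rfl⟩).trans
      (csInf_le (hne α hα p hpm hp).2 hpq)
  · exact le_csInf ⟨_, L, hLmeas, hLmem, rfl⟩ hlb
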